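/- Let n be a positive integer, e⃗ ∈ Ω, and let 𝓐' be a reduct of the full matrix algebra (M_n(𝔽), 𝔽, +, ×, +_𝔽, ×_𝔽, |·|) not containing the determinant operation |·|. Then 𝓐' is an e⃗-Ramsey algebra if and only if 𝓐' contains at most one of the two ring operations pertaining to the phylum A_{e⃗(0)} (that is: at most one of + and × if e⃗(0) = 1, and at most one of +_𝔽 and ×_𝔽 if e⃗(0) = 0). -/

import Mathlib

universe u v

/-- A (heterogeneous) operation: a list of input sorts, an output sort, and an
underlying function on lists of elements (only its values on lists of the right
length and sorts matter). -/
structure HetOp (I : Type u) (U : Type v) where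
  inSorts : List I
  outSort : I
  fn : List U → U

namespace HetRamsey

variable {I : Type u} {U : Type v}

/-- `f` maps the phyla prescribed by its input sorts into the phylum of its output sort. -/
def WellSorted (A : I → Set U) (f : HetOp I U) : Prop :=
  ∀ xs : List U, List.Forall₂ (fun x ξ => x ∈ A ξ) xs f.inSorts → f.fn xs ∈ A f.outSort

/-- Apply the operations in `hs` to consecutive chunks of the list `xs`. -/
def applyChunks : List (HetOp I U) → List U → List U
  | [], _ => []
  | h :: t, xs => h.fn (xs.take h.inSorts.length) :: applyChunks t (xs.drop h.inSorts.length)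

/-- The orderly terms over a family `F` of operations: `F` itself, the identity
operations, closed under orderly composition. -/
inductive OT (F : Set (HetOp I U)) : HetOp I U → Prop
  | base {f : HetOp I U} : f ∈ F → OT F f
  | id (ξ : I) (c : HetOp I U) :
      c.inSorts = [ξ] → c.outSort = ξ → (∀ x : U, c.fn [x] = x) → OT F c
  | comp (g : HetOp I U) (hs : List (HetOp I U)) :
      g ∈ F → (∀ h ∈ hs, OT F h) →
      List.Forall₂ (fun (h : HetOp I U) ξ => h.outSort = ξ) hs g.inSorts →
      OT F ⟨(hs.map HetOp.inSorts).flatten, g.outSort, fun xs => g.fn (applyChunks hs xs)⟩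

/-- `b` is `e`-sorted: the `i`-th term lies in phylum `A (e i)`. -/
def Sorted (A : I → Set U) (e : ℕ → I) (b : ℕ → U) : Prop :=
  ∀ i, b i ∈ A (e i)

/-- `a` is a reduction of `b` with respect to the family of operations `F`:
each term `a j` is obtained by applying an orderly term over `F` to a finite
subsequence of `b`, and these finite subsequences concatenate to a
subsequence of `b`. -/
def Reduction (A : I → Set U) (F : Set (HetOp I U)) (a b : ℕ → U) : Prop :=
  ∃ (φ : ℕ → List ℕ) (f : ℕ → HetOp I U),
    (∀ j, OT F (f j)) ∧
    (∀ j, (φ j).Chain' (· < ·)) ∧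
    (∀ j k, j < k → ∀ x ∈ φ j, ∀ y ∈ φ k, x < y) ∧
    (∀ j, List.Forall₂ (fun i ξ => b i ∈ A ξ) (φ j) (f j).inSorts) ∧
    (∀ j, a j = (f j).fn ((φ j).map b))

/-- `FR^e_F(b)`: the set of first terms of `e`-sorted reductions of `b`. -/
def FR (A : I → Set U) (F : Set (HetOp I U)) (e : ℕ → I) (b : ℕ → U) : Set U :=
  { x | ∃ a : ℕ → U, Reduction A F a b ∧ Sorted A e a ∧ a 0 = x }

/-- The algebra with phyla `A` and operations `F` is an `e`-Ramsey algebra. -/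
def IsERamsey (A : I → Set U) (F : Set (HetOp I U)) (e : ℕ → I) : Prop :=
  ∀ b : ℕ → U, Sorted A e b → ∀ X : Set U, X ⊆ A (e 0) →
    ∃ a : ℕ → U, Reduction A F a b ∧ Sorted A e a ∧
      (FR A F e a ⊆ X ∨ FR A F e a ∩ X = ∅)

/-- The homogeneous algebra `(A ξ, F)` is a Ramsey algebra: it is `e`-Ramsey for
the constant sort with value `ξ`. -/
def IsRamsey (A : I → Set U) (F : Set (HetOp I U)) (ξ : I) : Prop :=
  IsERamsey A F fun _ => ξ

/-- For a homogeneous algebra: `FR_G(α) = { f(τ) : f ∈ OT(G), τ a finite subsequence of α }`. -/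
def FRfin (A : I → Set U) (G : Set (HetOp I U)) (α : ℕ → U) : Set U :=
  { x | ∃ (f : HetOp I U) (ns : List ℕ), OT G f ∧ ns.Chain' (· < ·) ∧
      List.Forall₂ (fun i ξ => α i ∈ A ξ) ns f.inSorts ∧ x = f.fn (ns.map α) }

/-- `e ∈ Ω`: every value attained by the sort `e` is attained infinitely often. -/
def InOmega (e : ℕ → I) : Prop :=
  ∀ i, {j | e j = e i}.Infinite

end HetRamsey
namespace HetRamsey

/-- The underlying universe of a matrix algebra: scalars (left) and matrices (right). -/
abbrev MatU (𝔽 : Type) (n : ℕ) : Type := 𝔽 ⊕ Matrix (Fin n) (Fin n) 𝔽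

/-- The two phyla: index `0` is the scalar phylum `𝔽`, index `1` the matrix phylum. -/
def matPhyla (𝔽 : Type) (n : ℕ) : Fin 2 → Set (MatU 𝔽 n) :=
  fun i => if i = 0 then Set.range Sum.inl else Set.range Sum.inr

def toScal {𝔽 : Type} [Zero 𝔽] {n : ℕ} : MatU 𝔽 n → 𝔽
  | Sum.inl r => r
  | Sum.inr _ => 0

def toMat {𝔽 : Type} [Zero 𝔽] {n : ℕ} : MatU 𝔽 n → Matrix (Fin n) (Fin n) 𝔽
  | Sum.inl _ => 0
  | Sum.inr m => m

/-- Matrix addition as a heterogeneous operation. -/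
def matAddOp (𝔽 : Type) [Field 𝔽] (n : ℕ) : HetOp (Fin 2) (MatU 𝔽 n) :=
  ⟨[1, 1], 1, fun xs => match xs with
    | [x, y] => Sum.inr (toMat x + toMat y)
    | _ => Sum.inl 0⟩

/-- Matrix multiplication as a heterogeneous operation. -/
def matMulOp (𝔽 : Type) [Field 𝔽] (n : ℕ) : HetOp (Fin 2) (MatU 𝔽 n) :=
  ⟨[1, 1], 1, fun xs => match xs with
    | [x, y] => Sum.inr (toMat x * toMat y)
    | _ => Sum.inl 0⟩

/-- Field addition as a heterogeneous operation. -/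
def scalAddOp (𝔽 : Type) [Field 𝔽] (n : ℕ) : HetOp (Fin 2) (MatU 𝔽 n) :=
  ⟨[0, 0], 0, fun xs => match xs with
    | [x, y] => Sum.inl (toScal x + toScal y)
    | _ => Sum.inl 0⟩

/-- Field multiplication as a heterogeneous operation. -/
def scalMulOp (𝔽 : Type) [Field 𝔽] (n : ℕ) : HetOp (Fin 2) (MatU 𝔽 n) :=
  ⟨[0, 0], 0, fun xs => match xs with
    | [x, y] => Sum.inl (toScal x * toScal y)
    | _ => Sum.inl 0⟩

/-- The determinant as a heterogeneous operation from the matrix phylum to the scalar phylum. -/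
def detOp (𝔽 : Type) [Field 𝔽] (n : ℕ) : HetOp (Fin 2) (MatU 𝔽 n) :=
  ⟨[1], 0, fun xs => match xs with
    | [x] => Sum.inl (toMat x).det
    | _ => Sum.inl 0⟩

end HetRamsey

namespace HetRamsey

section General

variable {I : Type u} {U : Type v} {A : I → Set U} {S : Set (HetOp I U)} {e : ℕ → I}

/-- Induction on the values taken by orderly terms over a family of binary operations, each of
which has a single sort `p` as the sort of its inputs and of its output. -/
theorem OT.eval_induction (hbin : ∀ g ∈ S, g.inSorts = [g.outSort, g.outSort]) {p : I}
    (Q : List U → U → Prop) (hid : ∀ x ∈ A p, Q [x] x)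
    (hop : ∀ g ∈ S, g.outSort = p → ∀ xs ys u w, Q xs u → Q ys w → Q (xs ++ ys) (g.fn [u, w]))
    {f : HetOp I U} (hf : OT S f) (hp : f.outSort = p) {xs : List U}
    (hxs : List.Forall₂ (fun x ξ => x ∈ A ξ) xs f.inSorts) : Q xs (f.fn xs) := by
  induction hf generalizing xs with
  | @base g hg =>
    rw [hbin g hg, hp] at hxs
    obtain ⟨x, l, hx, hl, rfl⟩ := List.forall₂_cons_right_iff.1 hxs
    obtain ⟨y, l', hy, hl', rfl⟩ := List.forall₂_cons_right_iff.1 hl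
    obtain rfl := List.forall₂_nil_right_iff.1 hl'
    exact hop g hg hp [x] [y] x y (hid x hx) (hid y hy)
  | id ξ c hin hout hc =>
    rw [hout] at hp
    subst hp
    rw [hin] at hxs
    obtain ⟨x, l, hx, hl, rfl⟩ := List.forall₂_cons_right_iff.1 hxs
    obtain rfl := List.forall₂_nil_right_iff.1 hl
    rw [hc]
    exact hid x hx
  | comp g hs hg _ hout ih =>
    change g.outSort = p at hp
    rw [hbin g hg, hp] at hout
    obtain ⟨h₁, l, h₁p, hl, rfl⟩ := List.forall₂_cons_right_iff.1 hout
    obtain ⟨h₂, l', h₂p, hl', rfl⟩ := List.forall₂_cons_right_iff.1 hl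
    obtain rfl := List.forall₂_nil_right_iff.1 hl'
    simp only [List.map_cons, List.map_nil, List.flatten_cons, List.flatten_nil,
      List.append_nil] at hxs
    have e₁ := List.forall₂_take_append _ _ _ hxs
    have e₂ := List.forall₂_drop_append _ _ _ hxs
    have htake := List.take_of_length_le e₂.length_eq.le
    have q₁ := ih h₁ (by simp) h₁p e₁
    have q₂ := ih h₂ (by simp) h₂p e₂
    have := hop g hg hp _ _ _ _ q₁ q₂
    rw [List.take_append_drop] at this
    simpa only [applyChunks, htake] using this

theorem OT.fn_mem (hbin : ∀ g ∈ S, g.inSorts = [g.outSort, g.outSort])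
    (hws : ∀ g ∈ S, WellSorted A g) {f : HetOp I U} (hf : OT S f) {xs : List U}
    (hxs : List.Forall₂ (fun x ξ => x ∈ A ξ) xs f.inSorts) : f.fn xs ∈ A f.outSort := by
  refine hf.eval_induction hbin (fun _ u => u ∈ A f.outSort) (fun x hx => hx) ?_ rfl hxs
  intro g hg hp _ _ u w hu hw
  rw [← hp] at hu hw ⊢
  refine hws g hg _ ?_
  rw [hbin g hg]
  exact .cons hu (.cons hw .nil)

/-- The identity operation on the phylum `ξ` (with a default value for lists of the wrong length). -/
def idOp (d : U) (ξ : I) : HetOp I U := ⟨[ξ], ξ, fun xs => xs.headD d⟩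

theorem OT.idOp (d : U) (ξ : I) : OT S (idOp d ξ) := .id ξ _ rfl rfl fun _ => rfl

theorem exists_forall_mem_lt (l : List ℕ) : ∃ N, ∀ x ∈ l, x < N :=
  ⟨l.sum + 1, fun _ hx => Nat.lt_succ_of_le (List.single_le_sum (by simp) _ hx)⟩

/-- Consecutive blocks with prescribed properties can be chosen when each property is satisfied
by arbitrarily late blocks. -/
theorem exists_blocks (P : ℕ → List ℕ → Prop) (h : ∀ i N, ∃ l, P i l ∧ ∀ x ∈ l, N ≤ x) (N₀ : ℕ) :
    ∃ φ : ℕ → List ℕ, (∀ i, P i (φ i)) ∧ (∀ i, ∀ x ∈ φ i, N₀ ≤ x) ∧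
      ∀ j k, j < k → ∀ x ∈ φ j, ∀ y ∈ φ k, x < y := by
  choose F hP hF using h
  choose bd hbd using exists_forall_mem_lt
  let B : ℕ → ℕ := fun k => Nat.rec N₀ (fun i N => max N (bd (F i N))) k
  have hB : ∀ i, B (i + 1) = max (B i) (bd (F i (B i))) := fun _ => rfl
  have hmono : Monotone B := monotone_nat_of_le_succ fun i => by rw [hB]; exact le_max_left _ _
  refine ⟨fun i => F i (B i), fun i => hP _ _, fun i x hx => ?_, fun j k hjk x hx y hy => ?_⟩
  · exact (hmono (Nat.zero_le i)).trans (hF _ _ x hx)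
  · calc x < bd (F j (B j)) := hbd _ x hx
      _ ≤ B (j + 1) := by rw [hB]; exact le_max_right _ _
      _ ≤ B k := hmono hjk
      _ ≤ y := hF _ _ y hy

theorem InOmega.exists_ge (he : InOmega e) (i N : ℕ) : ∃ k, N ≤ k ∧ e k = e i := by
  obtain ⟨k, hk, hN⟩ := (he i).exists_gt N
  exact ⟨k, hN.le, hk⟩

/-- The value of an orderly term at a finite subsequence of an `e`-sorted sequence belongs to
`FR`, as the subsequence can be continued to an `e`-sorted reduction. -/
theorem InOmega.mem_FR (he : InOmega e) {a : ℕ → U} (ha : Sorted A e a) {f : HetOp I U}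
    (hf : OT S f) {ns : List ℕ} (hns : ns.Pairwise (· < ·))
    (hsort : List.Forall₂ (fun i ξ => a i ∈ A ξ) ns f.inSorts)
    (hmem : f.fn (ns.map a) ∈ A (e 0)) : f.fn (ns.map a) ∈ FR A S e a := by
  obtain ⟨N₀, hN₀⟩ := exists_forall_mem_lt ns
  obtain ⟨ψ, hψ, hψN, hlt⟩ := exists_blocks (fun i l => ∃ k, l = [k] ∧ e k = e i)
    (fun i N => let ⟨k, hk, hki⟩ := he.exists_ge i N; ⟨[k], ⟨k, rfl, hki⟩, by simpa using hk⟩) N₀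
  choose κ hκ heκ using hψ
  refine ⟨fun i => if i = 0 then f.fn (ns.map a) else a (κ i),
    ⟨fun i => if i = 0 then ns else ψ i, fun i => if i = 0 then f else HetRamsey.idOp (a 0) (e i),
      fun j => ?_, fun j => ?_, fun j k hjk => ?_, fun j => ?_, fun j => ?_⟩, fun j => ?_, rfl⟩
  · dsimp only
    split_ifs
    exacts [hf, OT.idOp _ _]
  · dsimp only
    split_ifs
    · exact List.isChain_iff_pairwise.2 hns
    · rw [hκ]
      exact List.isChain_singleton _
  · have hk : k ≠ 0 := by omega
    dsimp only
    rw [if_neg hk]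
    split_ifs
    · exact fun x hx y hy => (hN₀ x hx).trans_le (hψN k y hy)
    · exact hlt j k hjk
  · dsimp only
    split_ifs
    · exact hsort
    · rw [hκ]
      refine .cons ?_ .nil
      rw [← heκ]
      exact ha _
  · dsimp only
    split_ifs
    · rfl
    · rw [hκ]
      rfl
  · dsimp only
    split_ifs with hj
    · rwa [hj]
    · rw [← heκ]
      exact ha _

/-- To find a homogeneous reduction, it suffices to find a sequence of consecutive blocks in the
phylum `A (e 0)` that is homogeneous for orderly terms applied to this phylum only. -/
theorem InOmega.exists_reduction (he : InOmega e)
    (hbin : ∀ g ∈ S, g.inSorts = [g.outSort, g.outSort]) (hws : ∀ g ∈ S, WellSorted A g)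
    (hdis : ∀ x i j, x ∈ A i → x ∈ A j → i = j) {b : ℕ → U} (hb : Sorted A e b)
    (t : ℕ → List ℕ) (htne : ∀ i, t i ≠ []) (htch : ∀ i, (t i).Pairwise (· < ·))
    (htlt : ∀ i j, i < j → ∀ x ∈ t i, ∀ y ∈ t j, x < y) (f : ℕ → HetOp I U)
    (hf : ∀ i, OT S (f i))
    (hfs : ∀ i, List.Forall₂ (fun k ξ => b k ∈ A ξ) (t i) (f i).inSorts)
    (w : ℕ → U) (hw : ∀ i, w i = (f i).fn ((t i).map b)) (hwp : ∀ i, w i ∈ A (e 0)) (C : U → Prop)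
    (hC : ∀ (g : HetOp I U) (is : List ℕ), OT S g → g.outSort = e 0 → is.Pairwise (· < ·) →
      List.Forall₂ (fun x ξ => x ∈ A ξ) (is.map w) g.inSorts → C (g.fn (is.map w))) :
    ∃ a, Reduction A S a b ∧ Sorted A e a ∧ ∀ x ∈ FR A S e a, C x := by
  have hlate : ∀ N i, ∀ x ∈ t (N + i), N ≤ x := by
    intro N i
    induction N with
    | zero => simp
    | succ N ih =>
      intro x hx
      obtain ⟨y, hy⟩ := List.exists_mem_of_ne_nil _ (htne (N + i))
      have := htlt (N + i) (N + 1 + i) (by omega) y hy x hx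
      have := ih y hy
      omega
  obtain ⟨φ, hφ, -, hφlt⟩ := exists_blocks (fun i l => ∃ g, OT S g ∧ l.Pairwise (· < ·) ∧
      List.Forall₂ (fun k ξ => b k ∈ A ξ) l g.inSorts ∧ g.fn (l.map b) ∈ A (e i) ∧
      (e i = e 0 → ∃ m, l = t m ∧ g.fn (l.map b) = w m)) (by
    intro i N
    by_cases hi : e i = e 0
    · refine ⟨t (N + 0), ⟨f N, hf N, htch N, hfs N, ?_, fun _ => ⟨N, rfl, (hw N).symm⟩⟩,
        hlate N 0⟩
      rw [hi]
      exact (hw N) ▸ hwp N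
    · obtain ⟨k, hk, hki⟩ := he.exists_ge i N
      have hbk : b k ∈ A (e i) := hki ▸ hb k
      exact ⟨[k], ⟨HetRamsey.idOp (b 0) (e i), OT.idOp _ _, List.pairwise_singleton _ _,
        .cons hbk .nil, hbk, fun h => absurd h hi⟩, by simpa using hk⟩) 0
  choose g hg hch hgs hgm hgt using hφ
  refine ⟨fun i => (g i).fn ((φ i).map b),
    ⟨φ, g, hg, fun j => List.isChain_iff_pairwise.2 (hch j), hφlt, hgs, fun _ => rfl⟩, hgm, ?_⟩
  rintro x ⟨a', ⟨φ', f', hf', hch', -, hs', ha'⟩, hsorted, rfl⟩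
  set a : ℕ → U := fun i => (g i).fn ((φ i).map b) with hadef
  have hxs : List.Forall₂ (fun x ξ => x ∈ A ξ) ((φ' 0).map a) (f' 0).inSorts :=
    List.forall₂_map_left_iff.2 (hs' 0)
  have hout : (f' 0).outSort = e 0 := by
    refine hdis _ _ _ ((hf' 0).fn_mem hbin hws hxs) ?_
    rw [← ha']
    exact hsorted 0
  have hall : ∀ x ∈ (φ' 0).map a, x ∈ A (e 0) :=
    (hf' 0).eval_induction hbin (fun xs _ => ∀ x ∈ xs, x ∈ A (e 0)) (by simp)
      (fun _ _ _ xs ys _ _ h₁ h₂ x hx => (List.mem_append.1 hx).elim (h₁ x) (h₂ x)) hout hxs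
  have hep : ∀ i ∈ φ' 0, e i = e 0 := fun i hi =>
    hdis _ _ _ (hgm i) (hall _ (List.mem_map_of_mem hi))
  have hm : ∀ i, ∃ m, e i = e 0 → φ i = t m ∧ a i = w m := fun i => by
    by_cases hi : e i = e 0
    · obtain ⟨m, hm⟩ := hgt i hi
      exact ⟨m, fun _ => hm⟩
    · exact ⟨0, fun h => absurd h hi⟩
  choose m hm using hm
  have hmap : (φ' 0).map a = ((φ' 0).map m).map w := by
    rw [List.map_map]
    exact List.map_congr_left fun i hi => (hm i (hep i hi)).2
  have hmlt : ∀ i j, e i = e 0 → e j = e 0 → i < j → m i < m j := by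
    intro i j hi hj hij
    obtain ⟨x, hx⟩ := List.exists_mem_of_ne_nil _ (htne (m i))
    obtain ⟨y, hy⟩ := List.exists_mem_of_ne_nil _ (htne (m j))
    have hlt := hφlt i j hij
    rw [(hm i hi).1, (hm j hj).1] at hlt
    by_contra! hle
    rcases hle.eq_or_lt with heq | hlt'
    · rw [heq] at hlt
      exact lt_irrefl _ (hlt x hx x hx)
    · exact lt_asymm (hlt x hx y hy) (htlt _ _ hlt' y hy x hx)
  rw [ha', hmap]
  refine hC _ _ (hf' 0) hout ?_ (hmap ▸ hxs)
  rw [List.pairwise_map]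
  exact (List.isChain_iff_pairwise.1 (hch' 0)).imp_of_mem
    fun hi hj hij => hmlt _ _ (hep _ hi) (hep _ hj) hij

/-- If no operation outputs in the phylum `A (e 0)`, homogeneity is the pigeonhole principle. -/
theorem InOmega.isERamsey_of_no_op (he : InOmega e)
    (hbin : ∀ g ∈ S, g.inSorts = [g.outSort, g.outSort]) (hws : ∀ g ∈ S, WellSorted A g)
    (hdis : ∀ x i j, x ∈ A i → x ∈ A j → i = j) (hno : ∀ g ∈ S, g.outSort ≠ e 0) :
    IsERamsey A S e := by
  intro b hb X _
  have key : ∀ C : U → Prop, {k | e k = e 0 ∧ C (b k)}.Infinite →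
      ∃ a, Reduction A S a b ∧ Sorted A e a ∧ ∀ x ∈ FR A S e a, C x := by
    intro C hinf
    have hν : ∀ i, e (Nat.nth (fun k => e k = e 0 ∧ C (b k)) i) = e 0 ∧
        C (b (Nat.nth (fun k => e k = e 0 ∧ C (b k)) i)) :=
      fun i => Nat.nth_mem_of_infinite hinf i
    have hνm := Nat.nth_strictMono hinf
    set ν := Nat.nth (fun k => e k = e 0 ∧ C (b k))
    have hbν : ∀ i, b (ν i) ∈ A (e 0) := fun i => (hν i).1 ▸ hb (ν i)
    refine he.exists_reduction hbin hws hdis hb (fun i => [ν i]) (by simp) (by simp)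
      (fun i j hij => by simpa using hνm hij) (fun _ => HetRamsey.idOp (b 0) (e 0))
      (fun _ => OT.idOp _ _) (fun i => .cons (hbν i) .nil) (fun i => b (ν i)) (fun _ => rfl)
      hbν C ?_
    intro g is hg hout _ hs
    have := hg.eval_induction hbin (fun xs u => xs = [u]) (fun _ _ => rfl)
      (fun g hg hp => absurd hp (hno g hg)) hout hs
    have hmem : g.fn (is.map fun i => b (ν i)) ∈ is.map fun i => b (ν i) :=
      (congrArg (g.fn (is.map fun i => b (ν i)) ∈ ·) this).mpr (List.mem_singleton_self _)
    obtain ⟨i, -, hi⟩ := List.mem_map.1 hmem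
    rw [← hi]
    exact (hν i).2
  have hun : {k | e k = e 0} = {k | e k = e 0 ∧ b k ∈ X} ∪ {k | e k = e 0 ∧ b k ∉ X} := by
    ext k
    simp only [Set.mem_ofPred_eq, Set.mem_union]
    tauto
  have hinf := he 0
  rw [hun, Set.infinite_union] at hinf
  rcases hinf with h | h
  · obtain ⟨a, h₁, h₂, h₃⟩ := key (· ∈ X) h
    exact ⟨a, h₁, h₂, .inl h₃⟩
  · obtain ⟨a, h₁, h₂, h₃⟩ := key (· ∉ X) h
    exact ⟨a, h₁, h₂, .inr (Set.eq_empty_iff_forall_notMem.2 fun x hx => h₃ x hx.1 hx.2)⟩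

theorem prod_map_mem_FP {M : Type*} [Monoid M] (t : Stream' M) {is : List ℕ} (hne : is ≠ [])
    (his : is.Pairwise (· < ·)) {k : ℕ} (hk : ∀ i ∈ is, k ≤ i) :
    (is.map t.get).prod ∈ Hindman.FP (t.drop k) := by
  induction is generalizing k with
  | nil => exact absurd rfl hne
  | cons i l ih =>
    obtain ⟨d, rfl⟩ := Nat.exists_eq_add_of_le (hk i (by simp))
    have hsub : Hindman.FP (t.drop (k + d)) ⊆ Hindman.FP (t.drop k) := by
      have := Hindman.FP_drop_subset_FP (t.drop k) d
      rwa [Stream'.drop_drop] at this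
    apply hsub
    have hhead : (t.drop (k + d)).head = t.get (k + d) := by
      simp [Stream'.head, Stream'.get_drop]
    rcases eq_or_ne l [] with rfl | hl
    · simp only [List.map_cons, List.map_nil, List.prod_cons, List.prod_nil, mul_one]
      rw [← hhead]
      exact Hindman.FP.head _
    · rw [List.map_cons, List.prod_cons, ← hhead]
      refine Hindman.FP.cons _ _ ?_
      have hdrop : (t.drop (k + d)).tail = t.drop (k + d + 1) := by
        rw [Stream'.tail_eq_drop, Stream'.drop_drop]
      rw [hdrop]
      exact ih hl (List.pairwise_cons.1 his).2 fun j hj => (List.pairwise_cons.1 his).1 j hj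

/-- Hindman's theorem for finite increasing sequences of elements of an infinite set of natural
numbers, with respect to concatenation. -/
theorem exists_homogeneous_blocks {K : Set ℕ} (hK : K.Infinite) (C : List ℕ → Prop) :
    ∃ t : ℕ → List ℕ, (∀ i, t i ≠ []) ∧ (∀ i, (t i).Pairwise (· < ·)) ∧
      (∀ i, ∀ x ∈ t i, x ∈ K) ∧ (∀ i j, i < j → ∀ x ∈ t i, ∀ y ∈ t j, x < y) ∧
      ((∀ is : List ℕ, is ≠ [] → is.Pairwise (· < ·) → C (is.map t).flatten) ∨
        (∀ is : List ℕ, is ≠ [] → is.Pairwise (· < ·) → ¬ C (is.map t).flatten)) := by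
  let s : Stream' (FreeMonoid ℕ) := fun i => FreeMonoid.of (Nat.nth (· ∈ K) i)
  have hs : ∀ l ∈ Hindman.FP s, l.toList ≠ [] ∧ l.toList.Pairwise (· < ·) ∧
      ∀ x ∈ l.toList, x ∈ K := by
    have : ∀ (a : Stream' (FreeMonoid ℕ)) (l : FreeMonoid ℕ), l ∈ Hindman.FP a →
        ∀ k, a = s.drop k → l.toList ≠ [] ∧ l.toList.Pairwise (· < ·) ∧
          ∀ x ∈ l.toList, x ∈ K ∧ Nat.nth (· ∈ K) k ≤ x := by
      intro a l hl
      have hd : ∀ k, (s.drop k).tail = s.drop (k + 1) := fun k => by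
        rw [Stream'.tail_eq_drop, Stream'.drop_drop]
      have hh : ∀ k, (s.drop k).head = FreeMonoid.of (Nat.nth (· ∈ K) k) := fun k => by
        rw [Stream'.head, Stream'.get_drop]
        rfl
      have hmem : ∀ k, Nat.nth (· ∈ K) k ∈ K := Nat.nth_mem_of_infinite hK
      have hmono : StrictMono (Nat.nth (· ∈ K)) := Nat.nth_strictMono hK
      induction hl with
      | head' a =>
        rintro k rfl
        rw [hh]
        simp [FreeMonoid.toList_of, hmem]
      | tail' a l _ ih =>
        rintro k rfl
        obtain ⟨h₁, h₂, h₃⟩ := ih (k + 1) (hd k)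
        exact ⟨h₁, h₂, fun x hx => ⟨(h₃ x hx).1, (hmono.monotone k.le_succ).trans (h₃ x hx).2⟩⟩
      | cons' a l _ ih =>
        rintro k rfl
        obtain ⟨h₁, h₂, h₃⟩ := ih (k + 1) (hd k)
        have hlt : ∀ x ∈ l.toList, Nat.nth (· ∈ K) k < x :=
          fun x hx => (hmono k.lt_succ_self).trans_le (h₃ x hx).2
        rw [hh, FreeMonoid.toList_of_mul]
        refine ⟨by simp, List.pairwise_cons.2 ⟨hlt, h₂⟩, ?_⟩
        intro x hx
        rcases List.mem_cons.1 hx with rfl | hx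
        · exact ⟨hmem k, le_rfl⟩
        · exact ⟨(h₃ x hx).1, (hlt x hx).le⟩
    intro l hl
    obtain ⟨h₁, h₂, h₃⟩ := this s l hl 0 rfl
    exact ⟨h₁, h₂, fun x hx => (h₃ x hx).1⟩
  obtain ⟨c, hc, t, ht⟩ := Hindman.FP_partition_regular s
    {{l | l ∈ Hindman.FP s ∧ C l.toList}, {l | l ∈ Hindman.FP s ∧ ¬ C l.toList}} (by simp) (by
      intro l hl
      by_cases h : C l.toList
      · exact ⟨_, .inl rfl, hl, h⟩
      · exact ⟨_, .inr rfl, hl, h⟩)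
  have htFP : Hindman.FP t ⊆ Hindman.FP s := by
    rcases hc with rfl | rfl
    exacts [fun l hl => (ht hl).1, fun l hl => (ht hl).1]
  have hts : ∀ i, t.get i ∈ Hindman.FP s := fun i => htFP (Hindman.FP.singleton t i)
  have hflat : ∀ is : List ℕ, (is.map t.get).prod.toList =
      (is.map fun i => (t.get i).toList).flatten := fun is => by
    rw [FreeMonoid.toList_prod, List.map_map]
    rfl
  have hprod : ∀ is : List ℕ, is ≠ [] → is.Pairwise (· < ·) →
      (is.map t.get).prod ∈ Hindman.FP t := fun is hne his =>
    prod_map_mem_FP t hne his (k := 0) (by simp)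
  refine ⟨fun i => (t.get i).toList, fun i => (hs _ (hts i)).1, fun i => (hs _ (hts i)).2.1,
    fun i => (hs _ (hts i)).2.2, fun i j hij => ?_, ?_⟩
  · have := (hs _ (htFP (Hindman.FP.mul_two t i j hij))).2.1
    rw [FreeMonoid.toList_mul, List.pairwise_append] at this
    exact this.2.2
  · rcases hc with rfl | rfl
    · exact .inl fun is hne his => hflat is ▸ (ht (hprod is hne his)).2
    · exact .inr fun is hne his => hflat is ▸ (ht (hprod is hne his)).2

theorem exists_OT_prod {R : Type*} [Monoid R] (ι : R → U) {p : I} {g₀ : HetOp I U} (hg₀ : g₀ ∈ S)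
    (hin : g₀.inSorts = [p, p]) (hout : g₀.outSort = p)
    (hmul : ∀ x y, g₀.fn [ι x, ι y] = ι (x * y)) (m : ℕ) :
    ∃ f, OT S f ∧ f.outSort = p ∧ f.inSorts = List.replicate (m + 1) p ∧
      ∀ rs : List R, rs.length = m + 1 → f.fn (rs.map ι) = ι rs.prod := by
  induction m with
  | zero =>
    refine ⟨HetRamsey.idOp (ι 1) p, OT.idOp _ _, rfl, rfl, fun rs hrs => ?_⟩
    obtain ⟨r, rfl⟩ := List.length_eq_one_iff.1 hrs
    simp [HetRamsey.idOp]
  | succ m ih =>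
    obtain ⟨f, hf, hfo, hfi, hfp⟩ := ih
    refine ⟨_, .comp g₀ [HetRamsey.idOp (ι 1) p, f] hg₀ ?_ ?_, hout, ?_, ?_⟩
    · simp only [List.mem_cons, List.not_mem_nil, or_false]
      rintro h (rfl | rfl)
      exacts [OT.idOp _ _, hf]
    · rw [hin]
      exact .cons rfl (.cons hfo .nil)
    · simp [hfi, HetRamsey.idOp, List.replicate_succ]
    · rintro (_ | ⟨r, rs⟩) hrs
      · simp at hrs
      · have hlen : rs.length = m + 1 := by simpa using hrs
        have htake : (rs.map ι).take f.inSorts.length = rs.map ι :=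
          List.take_of_length_le (by simp [hfi, hlen])
        simp only [HetRamsey.idOp, applyChunks, List.map_cons, List.length_cons, List.length_nil,
          zero_add, List.take_succ_cons, List.take_zero, List.headD_cons, List.drop_succ_cons,
          List.drop_zero, htake, hfp rs hlen, hmul, List.prod_cons]

/-- If the phylum `A (e 0)` carries a single operation and that operation makes it a monoid, then
homogeneity follows from Hindman's theorem. -/
theorem InOmega.isERamsey_of_monoid (he : InOmega e)
    (hbin : ∀ g ∈ S, g.inSorts = [g.outSort, g.outSort]) (hws : ∀ g ∈ S, WellSorted A g)
    (hdis : ∀ x i j, x ∈ A i → x ∈ A j → i = j) {R : Type*} [Monoid R] (ι : R → U)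
    (hι : Set.range ι = A (e 0)) {g₀ : HetOp I U} (hg₀ : g₀ ∈ S) (hout : g₀.outSort = e 0)
    (hmul : ∀ x y, g₀.fn [ι x, ι y] = ι (x * y)) (huniq : ∀ g ∈ S, g.outSort = e 0 → g = g₀) :
    IsERamsey A S e := by
  intro b hb X _
  have hr : ∀ i, ∃ r, e i = e 0 → ι r = b i := fun i => by
    by_cases hi : e i = e 0
    · have := hb i
      rw [hi, ← hι] at this
      obtain ⟨r, hr⟩ := this
      exact ⟨r, fun _ => hr⟩
    · exact ⟨1, fun h => absurd h hi⟩
  choose r hr using hr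
  obtain ⟨t, htne, htch, htK, htlt, hhom⟩ := exists_homogeneous_blocks (he 0)
    (fun l => ι (l.map r).prod ∈ X)
  have htb : ∀ i, (t i).map b = ((t i).map r).map ι := fun i => by
    rw [List.map_map]
    exact List.map_congr_left fun k hk => (hr k (htK i k hk)).symm
  have hlen : ∀ i, (t i).length = (t i).length - 1 + 1 := fun i => by
    have := List.length_pos_of_ne_nil (htne i)
    omega
  choose f hf hfo hfi hfp using
    exists_OT_prod ι hg₀ (by rw [hbin g₀ hg₀, hout]) hout hmul
  have key : ∀ C : U → Prop, (∀ is : List ℕ, is ≠ [] → is.Pairwise (· < ·) →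
        C (ι ((is.map t).flatten.map r).prod)) →
      ∃ a, Reduction A S a b ∧ Sorted A e a ∧ ∀ x ∈ FR A S e a, C x := by
    intro C hC
    refine he.exists_reduction hbin hws hdis hb t htne htch htlt (fun i => f ((t i).length - 1))
      (fun i => hf _) (fun i => ?_) (fun i => ι ((t i).map r).prod) (fun i => ?_)
      (fun i => hι ▸ Set.mem_range_self _) C ?_
    · rw [hfi, ← hlen, List.forall₂_iff_get]
      refine ⟨by simp, fun k h₁ h₂ => ?_⟩
      have hk := htK i _ (List.get_mem (t i) ⟨k, h₁⟩)
      have := hb ((t i).get ⟨k, h₁⟩)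
      rw [show e ((t i).get ⟨k, h₁⟩) = e 0 from hk] at this
      simpa using this
    · rw [htb, hfp]
      simpa using hlen i
    · intro g is hg hgout his hs
      obtain ⟨hne, heval⟩ := hg.eval_induction hbin
        (fun xs u => xs ≠ [] ∧ ∀ rs : List R, xs = rs.map ι → u = ι rs.prod)
        (fun x _ => ⟨by simp, fun rs hrs => by
          obtain ⟨y, rfl, rfl⟩ := List.map_eq_singleton_iff.1 hrs.symm
          simp⟩)
        (fun g hg hp xs ys u w h₁ h₂ => ⟨by simp [h₁.1], fun rs hrs => by
          obtain ⟨rs₁, rs₂, rfl, e₁, e₂⟩ := List.map_eq_append_iff.1 hrs.symm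
          rw [huniq g hg hp, h₁.2 rs₁ e₁.symm, h₂.2 rs₂ e₂.symm, hmul, List.prod_append]⟩)
        hgout hs
      rw [heval (is.map fun i => ((t i).map r).prod) (by rw [List.map_map]; rfl)]
      have := hC is (by simpa using hne) his
      rwa [List.map_flatten, List.prod_flatten, List.map_map, List.map_map] at this
  rcases hhom with h | h
  · obtain ⟨a, h₁, h₂, h₃⟩ := key (· ∈ X) h
    exact ⟨a, h₁, h₂, .inl h₃⟩
  · obtain ⟨a, h₁, h₂, h₃⟩ := key (· ∉ X) h
    exact ⟨a, h₁, h₂, .inr (Set.eq_empty_iff_forall_notMem.2 fun x hx => h₃ x hx.1 hx.2)⟩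

end General

section Counterexample

/-- A positive rational whose valuations at `2` and `3` are `t` and `-s`, where the binary digits
of `t` and of `s` are all in positions between `lo` and `hi`. -/
def Spread (lo hi : ℕ) (v : ℚ) : Prop :=
  0 < v ∧ ∃ t s : ℕ, padicValRat 2 v = t ∧ padicValRat 3 v = -s ∧
    0 < t ∧ t < 2 ^ hi ∧ 2 ^ lo ∣ t ∧ 0 < s ∧ s < 2 ^ hi ∧ 2 ^ lo ∣ s

/-- A rational such that the binary digits of its valuation at `2` precede those of minus its
valuation at `3`. -/
def Separated (v : ℚ) : Prop :=
  ∃ k t s : ℕ, padicValRat 2 v = t ∧ padicValRat 3 v = -s ∧ t < 2 ^ k ∧ 2 ^ k ∣ s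

theorem Spread.mono {lo lo' hi hi' : ℕ} {v : ℚ} (h : Spread lo hi v) (hlo : lo' ≤ lo)
    (hhi : hi ≤ hi') : Spread lo' hi' v := by
  obtain ⟨hv, t, s, h2, h3, ht, htu, htd, hs, hsu, hsd⟩ := h
  have h₁ : 2 ^ hi ≤ 2 ^ hi' := Nat.pow_le_pow_right two_pos hhi
  have h₂ : 2 ^ lo' ∣ 2 ^ lo := pow_dvd_pow 2 hlo
  exact ⟨hv, t, s, h2, h3, ht, htu.trans_le h₁, h₂.trans htd, hs, hsu.trans_le h₁, h₂.trans hsd⟩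

theorem spread_base (i : ℕ) : Spread i (i + 1) ((2 / 3 : ℚ) ^ 2 ^ i) := by
  have h : 2 ^ i < 2 ^ (i + 1) := Nat.pow_lt_pow_right one_lt_two i.lt_succ_self
  have h22 : padicValRat 2 2 = 1 := by exact_mod_cast padicValRat.self (p := 2) one_lt_two
  have h33 : padicValRat 3 3 = 1 := by exact_mod_cast padicValRat.self (p := 3) (by norm_num)
  have h23 : padicValRat 2 3 = 0 := by
    have := padicValRat.of_nat (p := 2) (n := 3)
    rw [padicValNat.eq_zero_of_not_dvd (by norm_num)] at this
    exact_mod_cast this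
  have h32 : padicValRat 3 2 = 0 := by
    have := padicValRat.of_nat (p := 3) (n := 2)
    rw [padicValNat.eq_zero_of_not_dvd (by norm_num)] at this
    exact_mod_cast this
  refine ⟨by positivity, 2 ^ i, 2 ^ i, ?_, ?_, by positivity, h, dvd_rfl, by positivity, h, dvd_rfl⟩
  · rw [padicValRat.pow, padicValRat.div (by norm_num) (by norm_num), h22, h23]
    simp
  · rw [padicValRat.pow, padicValRat.div (by norm_num) (by norm_num), h33, h32]
    simp

/-- The valuations of a sum of consecutive spread rationals. -/
theorem padicValRat_add_of_spread {lo mid hi : ℕ} {x y : ℚ} (hx : Spread lo mid x)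
    (hy : Spread mid hi y) : padicValRat 2 (x + y) = padicValRat 2 x ∧
      padicValRat 3 (x + y) = padicValRat 3 y := by
  obtain ⟨hx, t, s, h2, h3, ht, htu, htd, hs, hsu, hsd⟩ := hx
  obtain ⟨hy, t', s', h2', h3', ht', htu', htd', hs', hsu', hsd'⟩ := hy
  have h₁ := Nat.le_of_dvd ht' htd'
  have h₂ := Nat.le_of_dvd hs' hsd'
  constructor
  · exact padicValRat.add_eq_of_lt (by positivity) hx.ne' hy.ne' (by rw [h2, h2']; omega)
  · rw [add_comm]
    exact padicValRat.add_eq_of_lt (by positivity) hy.ne' hx.ne' (by rw [h3, h3']; omega)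

theorem Spread.add {lo mid hi : ℕ} {x y : ℚ} (hx : Spread lo mid x) (hy : Spread mid hi y)
    (h₁ : lo ≤ mid) (h₂ : mid ≤ hi) : Spread lo hi (x + y) := by
  obtain ⟨e2, e3⟩ := padicValRat_add_of_spread hx hy
  obtain ⟨hx0, t, -, h2, -, ht, htu, htd, -⟩ := hx.mono le_rfl h₂
  obtain ⟨hy0, -, s, -, h3, -, -, -, hs, hsu, hsd⟩ := hy.mono h₁ le_rfl
  exact ⟨add_pos hx0 hy0, t, s, e2.trans h2, e3.trans h3, ht, htu, htd, hs, hsu, hsd⟩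

theorem Spread.separated_add {lo mid hi : ℕ} {x y : ℚ} (hx : Spread lo mid x)
    (hy : Spread mid hi y) : Separated (x + y) := by
  obtain ⟨e2, e3⟩ := padicValRat_add_of_spread hx hy
  obtain ⟨-, t, -, h2, -, -, htu, -⟩ := hx
  obtain ⟨-, -, s, -, h3, -, -, -, -, -, hsd⟩ := hy
  exact ⟨mid, t, s, e2.trans h2, e3.trans h3, htu, hsd⟩

theorem add_lt_two_pow {mid hi s t : ℕ} (hs : s < 2 ^ mid) (ht : t < 2 ^ hi) (hd : 2 ^ mid ∣ t)
    (h : mid ≤ hi) : s + t < 2 ^ hi := by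
  obtain ⟨c, rfl⟩ := hd
  obtain ⟨d, rfl⟩ := Nat.exists_eq_add_of_le h
  rw [pow_add] at ht ⊢
  have hcd : c + 1 ≤ 2 ^ d := lt_of_mul_lt_mul_left ht (Nat.zero_le _)
  calc s + 2 ^ mid * c < 2 ^ mid * (c + 1) := by rw [mul_add]; omega
    _ ≤ 2 ^ mid * 2 ^ d := Nat.mul_le_mul_left _ hcd

theorem Spread.mul {lo mid hi : ℕ} {x y : ℚ} (hx : Spread lo mid x) (hy : Spread mid hi y)
    (h₁ : lo ≤ mid) (h₂ : mid ≤ hi) : Spread lo hi (x * y) := by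
  obtain ⟨hx, t, s, h2, h3, ht, htu, htd, hs, hsu, hsd⟩ := hx
  obtain ⟨hy, t', s', h2', h3', ht', htu', htd', hs', hsu', hsd'⟩ := hy
  have hd : 2 ^ lo ∣ 2 ^ mid := pow_dvd_pow 2 h₁
  refine ⟨mul_pos hx hy, t + t', s + s', ?_, ?_, by omega, add_lt_two_pow htu htu' htd' h₂,
    dvd_add htd (hd.trans htd'), by omega, add_lt_two_pow hsu hsu' hsd' h₂,
    dvd_add hsd (hd.trans hsd')⟩
  · rw [padicValRat.mul hx.ne' hy.ne', h2, h2']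
    push_cast
    ring
  · rw [padicValRat.mul hx.ne' hy.ne', h3, h3']
    push_cast
    ring

theorem Spread.not_separated_mul {lo mid hi : ℕ} {x y : ℚ} (hx : Spread lo mid x)
    (hy : Spread mid hi y) : ¬ Separated (x * y) := by
  rintro ⟨k, T, S, hT, hS, hTk, hkS⟩
  obtain ⟨hx, t, s, h2, h3, ht, htu, htd, hs, hsu, hsd⟩ := hx
  obtain ⟨hy, t', s', h2', h3', ht', htu', htd', hs', hsu', hsd'⟩ := hy
  rw [padicValRat.mul hx.ne' hy.ne', h2, h2'] at hT
  rw [padicValRat.mul hx.ne' hy.ne', h3, h3'] at hS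
  obtain rfl : T = t + t' := by omega
  obtain rfl : S = s + s' := by omega
  have hle := Nat.le_of_dvd ht' htd'
  have hk : mid ≤ k := ((Nat.pow_lt_pow_iff_right one_lt_two).1 (by omega : 2 ^ mid < 2 ^ k)).le
  have hdvd : 2 ^ mid ∣ s := (Nat.dvd_add_left hsd').1 ((pow_dvd_pow 2 hk).trans hkS)
  exact absurd (Nat.le_of_dvd hs hdvd) (by omega)

variable {I : Type u} {U : Type v} {A : I → Set U} {S : Set (HetOp I U)} {e : ℕ → I}

/-- If the phylum `A (e 0)` is a ring containing the rationals, and its addition and its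
multiplication are both operations of the algebra, the algebra is not `e`-Ramsey. -/
theorem InOmega.not_isERamsey (he : InOmega e)
    (hbin : ∀ g ∈ S, g.inSorts = [g.outSort, g.outSort]) (hws : ∀ g ∈ S, WellSorted A g)
    (hdis : ∀ x i j, x ∈ A i → x ∈ A j → i = j) (hne : ∀ i, (A i).Nonempty)
    {R : Type*} [Ring R] [Nontrivial R] (c : ℚ →+* R) (ι : R → U) (hinj : Function.Injective ι)
    (hι : Set.range ι = A (e 0)) {ga gm : HetOp I U} (hga : ga ∈ S) (hgm : gm ∈ S)
    (hao : ga.outSort = e 0) (hmo : gm.outSort = e 0)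
    (hadd : ∀ x y, ga.fn [ι x, ι y] = ι (x + y)) (hmul : ∀ x y, gm.fn [ι x, ι y] = ι (x * y))
    (hall : ∀ g ∈ S, g.outSort = e 0 → g = ga ∨ g = gm) : ¬ IsERamsey A S e := by
  classical
  intro hram
  choose d hd using hne
  have hιA : ∀ r, ι r ∈ A (e 0) := fun r => hι ▸ Set.mem_range_self r
  let b : ℕ → U := fun i => if e i = e 0 then ι (c ((2 / 3 : ℚ) ^ 2 ^ i)) else d (e i)
  have hb : Sorted A e b := fun i => by
    dsimp only [b]
    split_ifs with h
    · rw [h]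
      exact hιA _
    · exact hd _
  obtain ⟨a, ⟨φ, f, hf, hch, hlt, hs, ha⟩, hsorted, hX⟩ :=
    hram b hb (Set.image (fun v => ι (c v)) {v | Separated v}) (by rintro _ ⟨v, -, rfl⟩; exact hιA _)
  have heval : ∀ j, e j = e 0 → φ j ≠ [] ∧ ∀ lo hi, (∀ i ∈ φ j, lo ≤ i ∧ i < hi) →
      ∃ v, Spread lo hi v ∧ a j = ι (c v) := by
    intro j hj
    have hxs : List.Forall₂ (fun x ξ => x ∈ A ξ) ((φ j).map b) (f j).inSorts :=
      List.forall₂_map_left_iff.2 (hs j)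
    have hout : (f j).outSort = e 0 := by
      refine hdis _ _ _ ((hf j).fn_mem hbin hws hxs) ?_
      rw [← ha, ← hj]
      exact hsorted j
    obtain ⟨h₁, h₂⟩ := (hf j).eval_induction hbin (p := e 0)
      (fun xs u => xs ≠ [] ∧ ∀ ns : List ℕ, xs = ns.map b → ns.Pairwise (· < ·) →
        ∀ lo hi, (∀ i ∈ ns, lo ≤ i ∧ i < hi) → ∃ v, Spread lo hi v ∧ u = ι (c v))
      (fun x hx => ⟨by simp, fun ns hns _ lo hi hb' => by
        obtain ⟨i, rfl, rfl⟩ := List.map_eq_singleton_iff.1 hns.symm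
        have hi : e i = e 0 := hdis _ _ _ (hb i) hx
        have := hb' i (by simp)
        exact ⟨_, (spread_base i).mono this.1 this.2, by simp [b, hi]⟩⟩)
      (fun g hg hp xs ys u w h₁ h₂ => ⟨by simp [h₁.1], fun ns hns hpw lo hi hb' => by
        obtain ⟨l₁, l₂, rfl, e₁, e₂⟩ := List.map_eq_append_iff.1 hns.symm
        have hl₁ : l₁ ≠ [] := by rintro rfl; exact h₁.1 e₁.symm
        have hl₂ : l₂ ≠ [] := by rintro rfl; exact h₂.1 e₂.symm
        obtain ⟨k, hk⟩ := List.exists_mem_of_ne_nil _ hl₁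
        obtain ⟨m, l, rfl⟩ := List.exists_cons_of_ne_nil hl₂
        obtain ⟨hp₁, hp₂, hp₁₂⟩ := List.pairwise_append.1 hpw
        have hm := hb' m (by simp)
        have hlom : lo ≤ m := (hb' k (by simp [hk])).1.trans (hp₁₂ k hk m (by simp)).le
        obtain ⟨x, hx, rfl⟩ := h₁.2 l₁ e₁.symm hp₁ lo m fun i hi =>
          ⟨(hb' i (by simp [hi])).1, hp₁₂ i hi m (by simp)⟩
        obtain ⟨y, hy, rfl⟩ := h₂.2 (m :: l) e₂.symm hp₂ m hi fun i hi => by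
          refine ⟨?_, (hb' i (List.mem_append_right _ hi)).2⟩
          rcases List.mem_cons.1 hi with rfl | hi
          · exact le_rfl
          · exact ((List.pairwise_cons.1 hp₂).1 i hi).le
        rcases hall g hg hp with rfl | rfl
        · exact ⟨x + y, hx.add hy hlom hm.2.le, by rw [hadd, map_add]⟩
        · exact ⟨x * y, hx.mul hy hlom hm.2.le, by rw [hmul, map_mul]⟩⟩)
      hout hxs
    refine ⟨by simpa using h₁, fun lo hi hb' => ?_⟩
    rw [ha]
    exact h₂ _ rfl (List.isChain_iff_pairwise.1 (hch j)) lo hi hb'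
  obtain ⟨j, hj, hej⟩ := he.exists_ge 0 1
  obtain ⟨hne₀, hv₀⟩ := heval 0 rfl
  obtain ⟨hne₁, hv₁⟩ := heval j hej
  obtain ⟨m, l, hml⟩ := List.exists_cons_of_ne_nil hne₁
  obtain ⟨hi, hhi⟩ := exists_forall_mem_lt (φ j)
  obtain ⟨x, hx, hax⟩ := hv₀ 0 m fun i hi =>
    ⟨Nat.zero_le _, hlt 0 j hj i hi m (by simp [hml])⟩
  obtain ⟨y, hy, hay⟩ := hv₁ m hi fun i hi => by
    refine ⟨?_, hhi i hi⟩
    have hp := List.isChain_iff_pairwise.1 (hch j)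
    rw [hml] at hi hp
    rcases List.mem_cons.1 hi with rfl | hi
    · exact le_rfl
    · exact ((List.pairwise_cons.1 hp).1 i hi).le
  have hmemFR : ∀ g ∈ S, g.outSort = e 0 → ∀ z, g.fn [ι (c x), ι (c y)] = ι z →
      ι z ∈ FR A S e a := by
    intro g hg hgo z hz
    have := he.mem_FR (S := S) hsorted (f := g) (.base hg) (ns := [0, j]) (by simpa using Nat.pos_of_ne_zero (by omega))
      (by
        rw [hbin g hg, hgo]
        exact .cons (hsorted 0) (.cons (hej ▸ hsorted j) .nil))
    simp only [List.map_cons, List.map_nil, hax, hay, hz] at this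
    exact this (hιA z)
  have hsum := hmemFR ga hga hao (c (x + y)) (by rw [hadd, map_add])
  have hprod := hmemFR gm hgm hmo (c (x * y)) (by rw [hmul, map_mul])
  rcases hX with hX | hX
  · obtain ⟨v, hv, hve⟩ := hX hprod
    rw [c.injective (hinj hve)] at hv
    exact hx.not_separated_mul hy hv
  · exact Set.eq_empty_iff_forall_notMem.1 hX _ ⟨hsum, _, hx.separated_add hy, rfl⟩

end Counterexample

section MatrixAlgebra

theorem eq_of_mem_matPhyla {𝔽 : Type} {n : ℕ} (x : MatU 𝔽 n) (i j : Fin 2)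
    (hi : x ∈ matPhyla 𝔽 n i) (hj : x ∈ matPhyla 𝔽 n j) : i = j := by
  fin_cases i <;> fin_cases j <;> rcases x with x | x <;> simp_all [matPhyla]

theorem matPhyla_nonempty (𝔽 : Type) [Field 𝔽] (n : ℕ) (i : Fin 2) :
    (matPhyla 𝔽 n i).Nonempty := by
  unfold matPhyla
  split_ifs <;> exact Set.range_nonempty _

variable {𝔽 : Type} [Field 𝔽] {n : ℕ} {S : Set (HetOp (Fin 2) (MatU 𝔽 n))}

theorem inSorts_eq_of_subset
    (hS : S ⊆ {matAddOp 𝔽 n, matMulOp 𝔽 n, scalAddOp 𝔽 n, scalMulOp 𝔽 n}) :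
    ∀ g ∈ S, g.inSorts = [g.outSort, g.outSort] := by
  intro g hg
  rcases hS hg with rfl | rfl | rfl | rfl <;> rfl

theorem wellSorted_of_subset
    (hS : S ⊆ {matAddOp 𝔽 n, matMulOp 𝔽 n, scalAddOp 𝔽 n, scalMulOp 𝔽 n}) :
    ∀ g ∈ S, WellSorted (matPhyla 𝔽 n) g := by
  intro g hg xs hxs
  rw [inSorts_eq_of_subset hS g hg] at hxs
  obtain ⟨x, l, -, hl, rfl⟩ := List.forall₂_cons_right_iff.1 hxs
  obtain ⟨y, l', -, hl', rfl⟩ := List.forall₂_cons_right_iff.1 hl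
  obtain rfl := List.forall₂_nil_right_iff.1 hl'
  rcases hS hg with rfl | rfl | rfl | rfl <;>
    simp [matPhyla, matAddOp, matMulOp, scalAddOp, scalMulOp]

theorem eq_or_eq_of_outSort_eq_one
    (hS : S ⊆ {matAddOp 𝔽 n, matMulOp 𝔽 n, scalAddOp 𝔽 n, scalMulOp 𝔽 n}) {g} (hg : g ∈ S)
    (h : g.outSort = 1) : g = matAddOp 𝔽 n ∨ g = matMulOp 𝔽 n := by
  rcases hS hg with rfl | rfl | rfl | rfl
  · exact .inl rfl
  · exact .inr rfl
  · exact absurd h zero_ne_one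
  · exact absurd h zero_ne_one

theorem eq_or_eq_of_outSort_eq_zero
    (hS : S ⊆ {matAddOp 𝔽 n, matMulOp 𝔽 n, scalAddOp 𝔽 n, scalMulOp 𝔽 n}) {g} (hg : g ∈ S)
    (h : g.outSort = 0) : g = scalAddOp 𝔽 n ∨ g = scalMulOp 𝔽 n := by
  rcases hS hg with rfl | rfl | rfl | rfl
  · exact absurd h one_ne_zero
  · exact absurd h one_ne_zero
  · exact .inl rfl
  · exact .inr rfl

/-- If at most one of two operations on the phylum `A (e 0)`, each of which makes it a monoid,
belongs to the algebra, and no other operation outputs in this phylum, then the algebra is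
`e`-Ramsey. -/
theorem InOmega.isERamsey_of_not_both {I : Type u} {U : Type v} {A : I → Set U}
    {S : Set (HetOp I U)} {e : ℕ → I} (he : InOmega e)
    (hbin : ∀ g ∈ S, g.inSorts = [g.outSort, g.outSort]) (hws : ∀ g ∈ S, WellSorted A g)
    (hdis : ∀ x i j, x ∈ A i → x ∈ A j → i = j) {R : Type*} [Ring R] (ι : R → U)
    (hι : Set.range ι = A (e 0)) {ga gm : HetOp I U} (hao : ga.outSort = e 0)
    (hmo : gm.outSort = e 0) (hadd : ∀ x y, ga.fn [ι x, ι y] = ι (x + y))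
    (hmul : ∀ x y, gm.fn [ι x, ι y] = ι (x * y))
    (hall : ∀ g ∈ S, g.outSort = e 0 → g = ga ∨ g = gm) (hnot : ¬ (ga ∈ S ∧ gm ∈ S)) :
    IsERamsey A S e := by
  by_cases ha : ga ∈ S
  · have hm : gm ∉ S := fun hm => hnot ⟨ha, hm⟩
    refine he.isERamsey_of_monoid (R := Multiplicative R) hbin hws hdis
      (fun r => ι r.toAdd) (by rw [← hι]; rfl) ha hao (fun x y => hadd _ _) fun g hg hgo => ?_
    exact (hall g hg hgo).resolve_right fun h => hm (h ▸ hg)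
  · have hma : ∀ g ∈ S, g.outSort = e 0 → g = gm := fun g hg hgo =>
      (hall g hg hgo).resolve_left fun h => ha (h ▸ hg)
    by_cases hm : gm ∈ S
    · exact he.isERamsey_of_monoid hbin hws hdis ι hι hm hmo hmul hma
    · exact he.isERamsey_of_no_op hbin hws hdis fun g hg hgo => hm (hma g hg hgo ▸ hg)

end MatrixAlgebra

end HetRamsey

open HetRamsey

/-- for `e ∈ Ω`, a reduct of the full matrix algebra not containing
the determinant is `e`-Ramsey iff it contains at most one of the two ring
operations pertaining to the phylum indexed by `e 0`. -/
theorem detFree_reduct_eRamsey_iff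
    (𝔽 : Type) [Field 𝔽] [CharZero 𝔽] (n : ℕ) (hn : 0 < n)
    (S : Set (HetOp (Fin 2) (MatU 𝔽 n)))
    (hS : S ⊆ {matAddOp 𝔽 n, matMulOp 𝔽 n, scalAddOp 𝔽 n, scalMulOp 𝔽 n})
    (e : ℕ → Fin 2) (he : InOmega e) :
    IsERamsey (matPhyla 𝔽 n) S e ↔
      ((e 0 = 1 → ¬(matAddOp 𝔽 n ∈ S ∧ matMulOp 𝔽 n ∈ S)) ∧
       (e 0 = 0 → ¬(scalAddOp 𝔽 n ∈ S ∧ scalMulOp 𝔽 n ∈ S))) := by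
  have hbin := inSorts_eq_of_subset hS
  have hws := wellSorted_of_subset hS
  have hdis := eq_of_mem_matPhyla (𝔽 := 𝔽) (n := n)
  have hne := matPhyla_nonempty 𝔽 n
  have : Nonempty (Fin n) := ⟨⟨0, hn⟩⟩
  rcases (by omega : e 0 = 0 ∨ e 0 = 1) with h0 | h0
  · have hι : Set.range (Sum.inl : 𝔽 → MatU 𝔽 n) = matPhyla 𝔽 n (e 0) := by
      simp [matPhyla, h0]
    have hall : ∀ g ∈ S, g.outSort = e 0 → g = scalAddOp 𝔽 n ∨ g = scalMulOp 𝔽 n :=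
      fun g hg h => eq_or_eq_of_outSort_eq_zero hS hg (h.trans h0)
    refine ⟨fun h => ⟨fun h1 => absurd (h0.symm.trans h1) zero_ne_one, fun _ hboth => ?_⟩,
      fun h => ?_⟩
    · exact he.not_isERamsey hbin hws hdis hne (algebraMap ℚ 𝔽) Sum.inl Sum.inl_injective hι
        hboth.1 hboth.2 h0.symm h0.symm (fun _ _ => rfl) (fun _ _ => rfl) hall h
    · exact he.isERamsey_of_not_both hbin hws hdis Sum.inl hι h0.symm h0.symm
        (fun _ _ => rfl) (fun _ _ => rfl) hall (h.2 h0)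
  · have hι : Set.range (Sum.inr : Matrix (Fin n) (Fin n) 𝔽 → MatU 𝔽 n) =
        matPhyla 𝔽 n (e 0) := by
      simp [matPhyla, h0]
    have hall : ∀ g ∈ S, g.outSort = e 0 → g = matAddOp 𝔽 n ∨ g = matMulOp 𝔽 n :=
      fun g hg h => eq_or_eq_of_outSort_eq_one hS hg (h.trans h0)
    refine ⟨fun h => ⟨fun _ hboth => ?_, fun h1 => absurd (h1.symm.trans h0) zero_ne_one⟩,
      fun h => ?_⟩
    · exact he.not_isERamsey hbin hws hdis hne (algebraMap ℚ (Matrix (Fin n) (Fin n) 𝔽)) Sum.inr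
        Sum.inr_injective hι hboth.1 hboth.2 h0.symm h0.symm (fun _ _ => rfl) (fun _ _ => rfl)
        hall h
    · exact he.isERamsey_of_not_both hbin hws hdis Sum.inr hι h0.symm h0.symm
        (fun _ _ => rfl) (fun _ _ => rfl) hall (h.1 h0)
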